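/- Let R be a commutative ring, Y a Stone space, and f : Y → Σ(R) a map continuous with respect to the Zariski topology on the set Σ(R) of subrings of R. Then for every y ∈ Y, f(y) = ⋃_U ⋂_{z ∈ U} f(z), where U ranges over the clopen subsets of Y containing y (an equality of subrings of R). -/

import Mathlib

/-- The Zariski topology on the set of subrings of a commutative ring `R`,
generated by the sets `{S | r ∈ S}` for `r ∈ R`. -/
instance zariskiTopology (R : Type*) [CommRing R] : TopologicalSpace (Subring R) :=
  TopologicalSpace.generateFrom {U : Set (Subring R) | ∃ r : R, U = {S : Subring R | r ∈ S}}

/-- If `Y` is a Stone space and `f : Y → Σ(R)` is continuous for the Zariski topology on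
the set of subrings of a commutative ring `R`, then for every `y ∈ Y`,
`f(y) = ⋃_U ⋂_{z ∈ U} f(z)`, where `U` ranges over the clopen subsets of `Y`
containing `y`. -/
theorem patchBundle_value_eq_iUnion_iInter (R : Type*) [CommRing R]
    (Y : Type*) [TopologicalSpace Y] [CompactSpace Y] [T2Space Y]
    [TotallyDisconnectedSpace Y] (f : Y → Subring R) (hf : Continuous f) (y : Y) :
    (f y : Set R) =
      ⋃ U ∈ {U : Set Y | IsClopen U ∧ y ∈ U}, ⋂ z ∈ U, (f z : Set R) := by
  ext r
  simp only [Set.mem_iUnion, Set.mem_iInter, Set.mem_setOf_eq, SetLike.mem_coe]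
  constructor
  · intro hr
    have ho : IsOpen {S : Subring R | r ∈ S} :=
      TopologicalSpace.isOpen_generateFrom_of_mem ⟨r, rfl⟩
    obtain ⟨V, hV, hyV, hVU⟩ := compact_exists_isClopen_in_isOpen (ho.preimage hf)
      (show y ∈ f ⁻¹' {S : Subring R | r ∈ S} from hr)
    exact ⟨V, ⟨hV, hyV⟩, fun z hz => hVU hz⟩
  · rintro ⟨U, ⟨_, hy⟩, h⟩
    exact h y hy
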